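/- arXiv:2203.01410 — 2 statements merged into one kernel-verified Lean document; each statement's English description precedes it below -/
import Mathlib

section
/- Let A be the 6×6 real matrix with rows (0,1,0,0,0,0), (1.000002542612694, 0, 0, 2, 0, 0), (0,0,0,1,0,0), (0, -0.000294117647059, 0, 0, 0, 0), (0,0,0,0,0,1), (0,0,0,0,-0.00000127311747,0), and let B be the 6×2 matrix whose columns are (0,0,0,1,0,0)ᵀ and (0,0,0,0,0,1)ᵀ (thrusters in the θ- and z-directions). Then the Kalman controllability matrix Q = [B, AB, A²B, A³B, A⁴B, A⁵B], viewed as a 6×12 real matrix, has rank 6, i.e., full rank. -/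
/-- Linearized satellite dynamics matrix under the `J₂` zonal harmonic. -/
def A : Matrix (Fin 6) (Fin 6) ℝ :=
  !![0, 1, 0, 0, 0, 0;
     1.000002542612694, 0, 0, 2, 0, 0;
     0, 0, 0, 1, 0, 0;
     0, -0.000294117647059, 0, 0, 0, 0;
     0, 0, 0, 0, 0, 1;
     0, 0, 0, 0, -0.00000127311747, 0]

/-- Input matrix: thruster columns. -/
def B : Matrix (Fin 6) (Fin 2) ℝ :=
  !![0, 0;
     0, 0;
     0, 0;
     1, 0;
     0, 0;
     0, 1]

/-- Kalman controllability matrix `Q = [B, AB, A²B, A³B, A⁴B, A⁵B]`,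
viewed as a `6 × 12` real matrix with columns indexed by `Fin 6 × Fin 2`. -/
def Q : Matrix (Fin 6) (Fin 6 × Fin 2) ℝ :=
  Matrix.of fun i p => (A ^ (p.1 : ℕ) * B) i p.2

lemma A_mul_B : A * B = !![0, 0; 2, 0; 1, 0; 0, 0; 0, 1; 0, 0] := by
  ext i j
  fin_cases i <;> fin_cases j <;> simp [A, B, Matrix.mul_apply, Fin.sum_univ_succ]

lemma A_sq_mul_B : A ^ 2 * B =
    !![2, 0; 0, 0; 0, 0; -0.000588235294118, 0; 0, 0; 0, -0.00000127311747] := by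
  rw [pow_two, Matrix.mul_assoc, A_mul_B]
  ext i j
  fin_cases i <;> fin_cases j <;> norm_num [A, Matrix.mul_apply, Fin.sum_univ_succ]

lemma A_cube_mul_B : A ^ 3 * B =
    !![0, 0; 1.998828614637152, 0; -0.000588235294118, 0; 0, 0; 0, -0.00000127311747; 0, 0] := by
  rw [pow_succ', Matrix.mul_assoc, A_sq_mul_B]
  ext i j
  fin_cases i <;> fin_cases j <;> norm_num [A, Matrix.mul_apply, Fin.sum_univ_succ]

/-- The rows of the controllability matrix are linearly independent. -/
lemma linearIndependent_row_Q : LinearIndependent ℝ Q.row := by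
  rw [Fintype.linearIndependent_iff]
  intro x hx
  have h (k : Fin 6) (j : Fin 2) : ∑ i, x i * (A ^ (k : ℕ) * B) i j = 0 := by
    simpa [Q, Finset.sum_apply] using congrFun hx (k, j)
  have h₀ := h 0 0
  have h₁ := h 1 0
  have h₂ := h 2 0
  have h₃ := h 3 0
  have z₀ := h 0 1
  have z₁ := h 1 1
  simp only [Fin.val_zero, Fin.val_one, Fin.val_two, show ((3 : Fin 6) : ℕ) = 3 from rfl,
    pow_zero, pow_one, Matrix.one_mul, A_mul_B, A_sq_mul_B, A_cube_mul_B]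
    at h₀ h₁ h₂ h₃ z₀ z₁
  simp [B, Fin.sum_univ_six] at h₀ h₁ h₂ h₃ z₀ z₁
  intro i
  fin_cases i <;> simp <;> linarith

theorem kalman_rank_thetaz : Q.rank = 6 := by
  simpa using linearIndependent_row_Q.rank_matrix
end

section
/- Let A be the 6×6 real matrix with rows (0,1,0,0,0,0), (1.000002542612694, 0, 0, 2, 0, 0), (0,0,0,1,0,0), (0, -0.000294117647059, 0, 0, 0, 0), (0,0,0,0,0,1), (0,0,0,0,-0.00000127311747,0), and let B be the 6×2 matrix whose columns are (0,0,0,1,0,0)ᵀ and (0,0,0,0,0,1)ᵀ (thrusters in the θ- and z-directions). Then the linear control system ẋ(t) = A x(t) + B u(t) is exactly controllable: for every t₀ < t₁ in ℝ and every pair of states x₀, x₁ ∈ ℝ⁶ there exist a continuous control u : ℝ → ℝ² and a differentiable trajectory x : ℝ → ℝ⁶ satisfying x′(t) = A x(t) + B u(t) for all t, x(t₀) = x₀ and x(t₁) = x₁. -/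
open Polynomial in
/-- A real polynomial is determined up to order `n` at a point by freely prescribed derivatives. -/
lemma exists_polynomial_iteratedDeriv_eq (n : ℕ) (t : ℝ) (a : ℕ → ℝ) :
    ∃ p : ℝ[X], ∀ k < n, iteratedDeriv k (fun s => p.eval s) t = a k := by
  have iter (p : ℝ[X]) (k : ℕ) :
      iteratedDeriv k (fun s => p.eval s) = fun s => (derivative^[k] p).eval s := by
    induction k with
    | zero => simp
    | succ k ih =>
      rw [iteratedDeriv_succ, ih, Function.iterate_succ_apply']
      ext s
      exact Polynomial.deriv _
  refine ⟨taylor (-t) (∑ i ∈ Finset.range n, monomial i (a i / i.factorial)), fun k hk => ?_⟩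
  simp only [iter]
  rw [← factorial_smul_hasseDeriv, LinearMap.smul_apply, eval_smul, ← taylor_coeff, taylor_taylor,
    add_neg_cancel, taylor_zero, finsetSum_coeff]
  simp [coeff_monomial, hk, mul_div_cancel₀, Nat.factorial_ne_zero]

/-- A smooth function can interpolate two given smooth functions near two distinct points. -/
lemma exists_contDiff_eventuallyEq {t₀ t₁ : ℝ} (h : t₀ < t₁) {p q : ℝ → ℝ} {n : ℕ∞}
    (hp : ContDiff ℝ n p) (hq : ContDiff ℝ n q) :
    ∃ f : ℝ → ℝ, ContDiff ℝ n f ∧ f =ᶠ[nhds t₀] p ∧ f =ᶠ[nhds t₁] q := by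
  have hd : 0 < t₁ - t₀ := sub_pos.2 h
  let s : ℝ → ℝ := fun t => Real.smoothTransition (3 * (t - t₀) / (t₁ - t₀) - 1)
  have hs : ContDiff ℝ n s := Real.smoothTransition.contDiff.comp (by fun_prop)
  refine ⟨fun t => p t + s t * (q t - p t), by fun_prop, ?_, ?_⟩
  · filter_upwards [Iio_mem_nhds (show t₀ < t₀ + (t₁ - t₀) / 3 by linarith)] with t ht
    have : s t = 0 := Real.smoothTransition.zero_of_nonpos <| by
      rw [sub_nonpos, div_le_one hd]
      linarith [Set.mem_Iio.1 ht]
    simp [this]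
  · filter_upwards [Ioi_mem_nhds (show t₀ + 2 * (t₁ - t₀) / 3 < t₁ by linarith)] with t ht
    have : s t = 1 := Real.smoothTransition.one_of_one_le <| by
      rw [le_sub_iff_add_le, le_div_iff₀ hd]
      linarith [Set.mem_Ioi.1 ht]
    simp [this]

/-- Hermite interpolation of prescribed derivatives at two points by a smooth function. -/
lemma exists_contDiff_iteratedDeriv_eq (n : ℕ) {t₀ t₁ : ℝ} (h : t₀ < t₁) (a b : ℕ → ℝ) :
    ∃ f : ℝ → ℝ, ContDiff ℝ n f ∧
      (∀ k < n, iteratedDeriv k f t₀ = a k) ∧ ∀ k < n, iteratedDeriv k f t₁ = b k := by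
  obtain ⟨p, hp⟩ := exists_polynomial_iteratedDeriv_eq n t₀ a
  obtain ⟨q, hq⟩ := exists_polynomial_iteratedDeriv_eq n t₁ b
  obtain ⟨f, hf, hfp, hfq⟩ := exists_contDiff_eventuallyEq h (n := n)
    (by simpa using p.contDiff_aeval n) (by simpa using q.contDiff_aeval n)
  exact ⟨f, hf, fun k hk => (hfp.iteratedDeriv_eq k).trans (hp k hk),
    fun k hk => (hfq.iteratedDeriv_eq k).trans (hq k hk)⟩

lemma ContDiff.hasDerivAt_iteratedDeriv {f : ℝ → ℝ} {n : ℕ∞} (hf : ContDiff ℝ n f) {k : ℕ}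
    (hk : k < n) (t : ℝ) : HasDerivAt (iteratedDeriv k f) (iteratedDeriv (k + 1) f t) t := by
  rw [iteratedDeriv_succ]
  exact (hf.differentiable_iteratedDeriv k (mod_cast hk) t).hasDerivAt

theorem controllable_thetaz :
    ∀ t₀ t₁ : ℝ, t₀ < t₁ → ∀ x₀ x₁ : Fin 6 → ℝ,
      ∃ u : ℝ → Fin 2 → ℝ, Continuous u ∧
        ∃ x : ℝ → Fin 6 → ℝ,
          (∀ t : ℝ, HasDerivAt x (A.mulVec (x t) + B.mulVec (u t)) t) ∧
          x t₀ = x₀ ∧ x t₁ = x₁ := by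
  intro t₀ t₁ h x₀ x₁
  -- The in-plane subsystem is flat: its trajectories are parametrized by a single scalar function
  -- `y`, whose value and first three derivatives form coordinates on the state space.
  let α : ℝ := 1.000002542612694
  let c : ℝ := 0.000294117647059
  let d : ℝ := 0.00000127311747
  have hα : α ≠ 0 := by norm_num [α]
  let jet (x : Fin 6 → ℝ) (k : ℕ) : ℝ :=
    ![(x 1 / 2 - x 2) / α, x 0 / 2, x 1 / 2, x 3 + α * (x 0 / 2)] (Fin.ofNat 4 k)
  let jetz (x : Fin 6 → ℝ) (k : ℕ) : ℝ := ![x 4, x 5] (Fin.ofNat 2 k)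
  obtain ⟨y, hy, hy₀, hy₁⟩ := exists_contDiff_iteratedDeriv_eq 4 h (jet x₀) (jet x₁)
  obtain ⟨z, hz, hz₀, hz₁⟩ := exists_contDiff_iteratedDeriv_eq 2 h (jetz x₀) (jetz x₁)
  let Y (k : ℕ) : ℝ → ℝ := iteratedDeriv k y
  let Z (k : ℕ) : ℝ → ℝ := iteratedDeriv k z
  let x (t : ℝ) : Fin 6 → ℝ :=
    ![2 * Y 1 t, 2 * Y 2 t, Y 2 t - α * Y 0 t, Y 3 t - α * Y 1 t, Z 0 t, Z 1 t]
  have endpoint (t : ℝ) (w : Fin 6 → ℝ) (hY : ∀ k < 4, Y k t = jet w k)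
      (hZ : ∀ k < 2, Z k t = jetz w k) : x t = w := by
    have e0 : Y 0 t = (w 1 / 2 - w 2) / α := hY 0 (by norm_num)
    have e1 : Y 1 t = w 0 / 2 := hY 1 (by norm_num)
    have e2 : Y 2 t = w 1 / 2 := hY 2 (by norm_num)
    have e3 : Y 3 t = w 3 + α * (w 0 / 2) := hY 3 (by norm_num)
    have f0 : Z 0 t = w 4 := hZ 0 (by norm_num)
    have f1 : Z 1 t = w 5 := hZ 1 (by norm_num)
    ext i
    fin_cases i <;> simp [x, e0, e1, e2, e3, f0, f1, mul_div_cancel₀, hα]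
  have Y' (k : ℕ) (hk : k < 4) (t : ℝ) : HasDerivAt (Y k) (Y (k + 1) t) t :=
    hy.hasDerivAt_iteratedDeriv (n := 4) (mod_cast hk) t
  have Z' (k : ℕ) (hk : k < 2) (t : ℝ) : HasDerivAt (Z k) (Z (k + 1) t) t :=
    hz.hasDerivAt_iteratedDeriv (n := 2) (mod_cast hk) t
  have cY (k : ℕ) (hk : k ≤ 4) : Continuous (Y k) :=
    hy.continuous_iteratedDeriv k (mod_cast hk)
  have cZ (k : ℕ) (hk : k ≤ 2) : Continuous (Z k) :=
    hz.continuous_iteratedDeriv k (mod_cast hk)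
  refine ⟨fun t => ![Y 4 t - α * Y 2 t + c * (2 * Y 2 t), Z 2 t + d * Z 0 t], ?_, x, ?_,
    endpoint t₀ x₀ hy₀ hz₀, endpoint t₁ x₁ hy₁ hz₁⟩
  · have := cY 4 le_rfl
    have := cY 2 (by norm_num)
    have := cZ 2 le_rfl
    have := cZ 0 (by norm_num)
    refine continuous_pi fun i => ?_
    fin_cases i <;> simp <;> fun_prop
  · intro t
    have y0 := Y' 0 (by norm_num) t
    have y1 := Y' 1 (by norm_num) t
    have y2 := Y' 2 (by norm_num) t
    have y3 := Y' 3 (by norm_num) t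
    refine hasDerivAt_pi.2 fun i => ?_
    fin_cases i
    · refine (y1.const_mul 2).congr_deriv ?_
      simp [A, B, x]
    · refine (y2.const_mul 2).congr_deriv ?_
      simp [A, B, x, α]
      ring
    · refine (y2.sub (y0.const_mul α)).congr_deriv ?_
      simp [A, B, x]
    · refine (y3.sub (y1.const_mul α)).congr_deriv ?_
      simp [A, B, x, c]
      ring
    · refine (Z' 0 (by norm_num) t).congr_deriv ?_
      simp [A, B, x]
    · refine (Z' 1 (by norm_num) t).congr_deriv ?_
      simp [A, B, x, d]
      ring
end
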